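/- Let M be a feasible irreducible connection 8-pattern that decomposes into three sequential swaps M[X], M[Y], M[Z] with [8] = X ⊎ Y ⊎ Z, X = {i, j}, |Y| = |Z| = 3, and suppose {i−1, i+1} ⊆ Y and {j−1, j+1} ⊆ Z. Then for at least one of the pairs (a, A) ∈ {(i, Y), (j, Z)} all of the following hold: (1) a−2 ∉ A and a+2 ∉ A; (2) the connection pattern obtained from M by swapping a and a+1 is either feasible or reducible; (3) the connection pattern obtained from M by swapping a and a−1 is either feasible or reducible. -/

import Mathlib

/-!  Connection patterns for `k`-opt swaps (1-indexed: deleted edges are indexed by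
`[k] = Finset.Icc 1 k`, pattern vertices `2i-1` and `2i` are the left and right endpoints
of the `i`-th deleted edge). -/

/-- The pattern vertices corresponding to an index set `X ⊆ [k]`:
`{2i−1, 2i : i ∈ X}`. -/
def pvs (X : Finset ℕ) : Finset ℕ := X.biUnion fun i => {2 * i - 1, 2 * i}

/-- `N` is a perfect matching on the vertex set `S`: its edges are loopless, lie inside
`S`, and every vertex of `S` is on exactly one edge of `N`. -/
def IsMatchingOn (N : Finset (Sym2 ℕ)) (S : Finset ℕ) : Prop :=
  (∀ e ∈ N, ¬ e.IsDiag) ∧ (∀ e ∈ N, ∀ v ∈ e, v ∈ S) ∧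
  (∀ v ∈ S, ∃! e, e ∈ N ∧ v ∈ e)

/-- The cyclic successor of `i` in the finite set `X`. -/
noncomputable def nextIn (X : Finset ℕ) (i : ℕ) : ℕ :=
  if h : (X.filter fun j => i < j).Nonempty then (X.filter fun j => i < j).min' h
  else if h' : X.Nonempty then X.min' h' else 0

/-- The "segment" edges of an index set `X`: for each `i ∈ X`, joining the right endpoint
`2i` of the `i`-th deleted edge to the left endpoint `2·nextIn X i − 1` of the cyclically
next deleted edge (representing the path of the Hamiltonian cycle between them). -/
noncomputable def segEdges (X : Finset ℕ) : Finset (Sym2 ℕ) :=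
  X.image fun i => s(2 * i, 2 * nextIn X i - 1)

/-- The sub-pattern `M[X]` of `M`: the edges of `M` lying inside `{2i−1, 2i : i ∈ X}`. -/
def subPat (M : Finset (Sym2 ℕ)) (X : Finset ℕ) : Finset (Sym2 ℕ) :=
  M.filter fun e => e ∈ (pvs X).sym2

/-- The connection pattern `N` on index set `X` is feasible: a swap fitting into it turns
a Hamiltonian cycle into a single Hamiltonian cycle again.  Intrinsically: the (2-regular)
graph on `{2i−1, 2i : i ∈ X}` consisting of the matching `N` together with the segment
edges of `X` is a single cycle, i.e. connected. -/
def FeasiblePat (N : Finset (Sym2 ℕ)) (X : Finset ℕ) : Prop :=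
  ∀ u ∈ pvs X, ∀ v ∈ pvs X,
    (SimpleGraph.fromEdgeSet ((N ∪ segEdges X : Finset (Sym2 ℕ)) : Set (Sym2 ℕ))).Reachable u v

/-- The connection pattern `N` on index set `X` is sequential:
`N ∪ {{2i−1, 2i} : i ∈ X}` forms a single (simple) cycle. -/
def SequentialPat (N : Finset (Sym2 ℕ)) (X : Finset ℕ) : Prop :=
  ∀ u ∈ pvs X, ∀ v ∈ pvs X,
    (SimpleGraph.fromEdgeSet
      ((N ∪ X.image fun i => s(2 * i - 1, 2 * i) : Finset (Sym2 ℕ)) : Set (Sym2 ℕ))).Reachable u v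

/-- A connection `k`-pattern `M` is reducible if it decomposes into two feasible patterns
(two moves). -/
def Reducible (M : Finset (Sym2 ℕ)) (k : ℕ) : Prop :=
  ∃ X Y : Finset ℕ, X ∪ Y = Finset.Icc 1 k ∧ Disjoint X Y ∧ X.Nonempty ∧ Y.Nonempty ∧
    IsMatchingOn (subPat M X) (pvs X) ∧ IsMatchingOn (subPat M Y) (pvs Y) ∧
    FeasiblePat (subPat M X) X ∧ FeasiblePat (subPat M Y) Y

/-- The number of interactions between index sets `X` and `Y` inside `[k]`. -/
def numInteractions (k : ℕ) (X Y : Finset ℕ) : ℕ :=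
  ((Finset.Icc 1 (k - 1)).filter fun i =>
    (i ∈ X ∧ i + 1 ∈ Y) ∨ (i ∈ Y ∧ i + 1 ∈ X)).card

/-- The pattern obtained from `M` by swapping `i` and `i+1`: exchange the matching
partners of `2i−1` and `2i+1`, and exchange the matching partners of `2i` and `2i+2`. -/
def swapAdjPat (M : Finset (Sym2 ℕ)) (i : ℕ) : Finset (Sym2 ℕ) :=
  M.image (Sym2.map fun m => Equiv.swap (2 * i - 1) (2 * i + 1) (Equiv.swap (2 * i) (2 * i + 2) m))

/-- Insert the vertex set `m` into a list of pairwise disjoint vertex sets (all encoded by their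
bits), uniting it with those it meets. -/
def insertMask : ℕ → List ℕ → List ℕ
  | m, [] => [m]
  | m, c :: cs => bif (m.land c).beq 0 then c :: insertMask m cs else insertMask (m.lor c) cs

/-- The vertex sets of the connected components of the graph with edge list `L`. -/
def components (L : List (ℕ × ℕ)) : List ℕ :=
  L.foldr (fun p => insertMask ((Nat.pow 2 p.1).lor (Nat.pow 2 p.2))) []

/-- The cyclic successor of `i` in a strictly increasing list. -/
def nextOf (S : List ℕ) (i : ℕ) : ℕ := (S.filter fun j => i.blt j).headD (S.headD 0)

/-- The segment edges of a strictly increasing list of indices. -/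
def segList (S : List ℕ) : List (ℕ × ℕ) := S.map fun i => (2 * i, 2 * nextOf S i - 1)

/-- The edges of `L` lying inside the vertex set of `S`. -/
def subList (L : List (ℕ × ℕ)) (S : List ℕ) : List (ℕ × ℕ) :=
  L.filter fun p => S.any (fun i => ((p.1 + 1) / 2).beq i) && S.any fun i => ((p.2 + 1) / 2).beq i

/-- Boolean test for feasibility. -/
def feasible (L : List (ℕ × ℕ)) (S : List ℕ) : Bool :=
  let r := (components (L ++ segList S)).headD 0
  S.all fun i => !(r.land (Nat.pow 2 (2 * i - 1))).beq 0 && !(r.land (Nat.pow 2 (2 * i))).beq 0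

/-- The elements of `T` in `[8]`, in increasing order. -/
def inside (T : List ℕ) : List ℕ := (List.range' 1 8).filter fun i => T.any i.beq

/-- The elements of `[8]` outside `T`, in increasing order. -/
def outside (T : List ℕ) : List ℕ := (List.range' 1 8).filter fun i => !T.any i.beq

/-- Boolean test for `T` and its complement to decompose `L` into two feasible patterns. -/
def splits (L : List (ℕ × ℕ)) (T : List ℕ) : Bool :=
  !(inside T).isEmpty && !(outside T).isEmpty &&
  L.all (fun p => (T.any ((p.1 + 1) / 2).beq).xor (!T.any ((p.2 + 1) / 2).beq)) &&
  feasible (subList L (inside T)) (inside T) && feasible (subList L (outside T)) (outside T)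

/-- The vertex permutation induced by swapping the indices `i` and `i + 1`. -/
def swapVertex (i m : ℕ) : ℕ :=
  bif m.beq (2 * i - 1) then 2 * i + 1 else bif m.beq (2 * i + 1) then 2 * i - 1 else
  bif m.beq (2 * i) then 2 * i + 2 else bif m.beq (2 * i + 2) then 2 * i else m

/-- The edge list after swapping the indices `i` and `i + 1`. -/
def swapList (L : List (ℕ × ℕ)) (i : ℕ) : List (ℕ × ℕ) :=
  L.map fun p => (swapVertex i p.1, swapVertex i p.2)

/-- The index list after swapping the indices `a` and `a + 1`. -/
def swapIndex (T : List ℕ) (a : ℕ) : List ℕ :=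
  T.map fun x => bif x.beq a then a + 1 else bif x.beq (a + 1) then a else x

/-- Boolean test for being feasible or reducible along one of the index lists in `Ts`. -/
def feasibleOrSplits (L : List (ℕ × ℕ)) (Ts : List (List ℕ)) : Bool :=
  feasible L (List.range' 1 8) || Ts.any (splits L)

/-- Boolean version of the conclusion for the pair `(a, A)`. -/
def swapsWell (L : List (ℕ × ℕ)) (Ts : List (List ℕ)) (a : ℕ) (A : List ℕ) : Bool :=
  !A.any (a - 2).beq && !A.any (a + 2).beq &&
  feasibleOrSplits (swapList L a) (Ts.map fun T => swapIndex T a) &&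
  feasibleOrSplits (swapList L (a - 1)) (Ts.map fun T => swapIndex T (a - 1))

/-- The sequential patterns on two indices. -/
def patterns₂ (a b : ℕ) : List (List (ℕ × ℕ)) :=
  [[(2 * a - 1, 2 * b - 1), (2 * a, 2 * b)], [(2 * a - 1, 2 * b), (2 * a, 2 * b - 1)]]

/-- The sequential patterns on three indices `a, b, c` matching the left vertex of `a` to a vertex
of `b`. -/
def halfPatterns₃ (a b c : ℕ) : List (List (ℕ × ℕ)) :=
  [[(2 * a - 1, 2 * b - 1), (2 * a, 2 * c - 1), (2 * b, 2 * c)],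
   [(2 * a - 1, 2 * b - 1), (2 * a, 2 * c), (2 * b, 2 * c - 1)],
   [(2 * a - 1, 2 * b), (2 * a, 2 * c - 1), (2 * b - 1, 2 * c)],
   [(2 * a - 1, 2 * b), (2 * a, 2 * c), (2 * b - 1, 2 * c - 1)]]

/-- The sequential patterns on three indices. -/
def patterns₃ (a b c : ℕ) : List (List (ℕ × ℕ)) := halfPatterns₃ a b c ++ halfPatterns₃ a c b

/-- Boolean version of the theorem for a fixed pattern. -/
def goodPattern (i j y z : ℕ) (L : List (ℕ × ℕ)) : Bool :=
  let Ts := [[i, j], [i - 1, i + 1, y], [j - 1, j + 1, z]]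
  !feasible L (List.range' 1 8) || Ts.any (splits L) ||
  swapsWell L Ts i [i - 1, i + 1, y] || swapsWell L Ts j [j - 1, j + 1, z]

/-- `[8] = {i, j} ∪ {i - 1, i + 1, y} ∪ {j - 1, j + 1, z}`. -/
def covers (i j y z : ℕ) : Bool :=
  (List.range' 1 8).all fun k => [i, j, i - 1, i + 1, y, j - 1, j + 1, z].any k.beq

/-- Boolean version of the theorem for a fixed partition of `[8]`. -/
def goodPartition (i j y z : ℕ) : Bool :=
  j.ble i || !covers i j y z ||
  (patterns₂ i j).all fun lx => (patterns₃ (i - 1) (i + 1) y).all fun ly =>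
    (patterns₃ (j - 1) (j + 1) z).all fun lz => goodPattern i j y z (lx ++ (ly ++ lz))

theorem goodPartition_of_le :
    ∀ i ∈ List.range' 1 8, ∀ j ∈ List.range' 1 8, ∀ y ∈ List.range' 1 8, ∀ z ∈ List.range' 1 8,
      goodPartition i j y z = true := by
  decide +kernel

/-- The finite set of edges `N` is listed by `L`. -/
def Represents (N : Finset (Sym2 ℕ)) (L : List (ℕ × ℕ)) : Prop :=
  ∀ e, e ∈ N ↔ ∃ p ∈ L, s(p.1, p.2) = e

theorem mem_pvs {A : Finset ℕ} {u : ℕ} : u ∈ pvs A ↔ (u + 1) / 2 ∈ A := by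
  simp only [pvs, Finset.mem_biUnion, Finset.mem_insert, Finset.mem_singleton]
  constructor
  · rintro ⟨i, hi, h⟩
    obtain rfl : (u + 1) / 2 = i := by omega
    exact hi
  · exact fun h => ⟨_, h, by omega⟩

/-! ### Connected components -/

theorem forall_insertMask {P : ℕ → Prop} (hP : ∀ m c, P m → P c → m &&& c ≠ 0 → P (m ||| c)) :
    ∀ (cs : List ℕ) (m : ℕ), P m → (∀ c ∈ cs, P c) → ∀ r ∈ insertMask m cs, P r
  | [], m, hm, _, r, hr => by
    simp only [insertMask, List.mem_singleton] at hr
    exact hr ▸ hm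
  | c :: cs, m, hm, hcs, r, hr => by
    have hc := hcs c List.mem_cons_self
    have hcs' : ∀ c ∈ cs, P c := fun c h => hcs c (List.mem_cons_of_mem _ h)
    cases h : (m.land c).beq 0 with
    | true =>
      simp only [insertMask, h, cond_true, List.mem_cons] at hr
      rcases hr with rfl | hr
      · exact hc
      · exact forall_insertMask hP cs m hm hcs' r hr
    | false =>
      simp only [insertMask, h, cond_false] at hr
      exact forall_insertMask hP cs _ (hP m c hm hc (Nat.ne_of_beq_eq_false h)) hcs' r hr

theorem exists_insertMask : ∀ (cs : List ℕ) (m x : ℕ), x ∈ m :: cs →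
    ∃ r ∈ insertMask m cs, ∀ u, x.testBit u → r.testBit u
  | [], m, x, hx => ⟨x, by simpa [insertMask] using hx, fun _ => id⟩
  | c :: cs, m, x, hx => by
    cases h : (m.land c).beq 0 with
    | true =>
      simp only [insertMask, h, cond_true]
      by_cases hxc : x = c
      · exact ⟨c, List.mem_cons_self, by simp [hxc]⟩
      · obtain ⟨r, hr, hxr⟩ := exists_insertMask cs m x (by simp_all)
        exact ⟨r, List.mem_cons_of_mem _ hr, hxr⟩
    | false =>
      simp only [insertMask, h, cond_false]
      by_cases hx' : x ∈ cs
      · exact exists_insertMask cs _ x (List.mem_cons_of_mem _ hx')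
      · obtain ⟨r, hr, hxr⟩ := exists_insertMask cs (m ||| c) (m ||| c) List.mem_cons_self
        refine ⟨r, hr, fun u hu => hxr u ?_⟩
        rw [Nat.testBit_or]
        have : x = m ∨ x = c := by simp_all
        rcases this with rfl | rfl <;> simp [hu]

theorem pairwise_insertMask : ∀ (cs : List ℕ) (m : ℕ), cs.Pairwise (fun a b => a &&& b = 0) →
    (insertMask m cs).Pairwise fun a b => a &&& b = 0
  | [], m, _ => by simp [insertMask]
  | c :: cs, m, h => by
    rw [List.pairwise_cons] at h
    cases hmc : (m.land c).beq 0 with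
    | true =>
      simp only [insertMask, hmc, cond_true, List.pairwise_cons]
      refine ⟨?_, pairwise_insertMask cs m h.2⟩
      refine forall_insertMask (P := fun r => c &&& r = 0) ?_ cs m ?_ h.1
      · intro a b ha hb _
        rw [Nat.and_or_distrib_left, ha, hb]
        rfl
      · rw [Nat.and_comm]
        exact Nat.eq_of_beq_eq_true hmc
    | false =>
      simp only [insertMask, hmc, cond_false]
      exact pairwise_insertMask cs _ h.2

theorem forall_components {P : ℕ → Prop} (hP : ∀ m c, P m → P c → m &&& c ≠ 0 → P (m ||| c)) :
    ∀ L : List (ℕ × ℕ), (∀ p ∈ L, P (2 ^ p.1 ||| 2 ^ p.2)) → ∀ r ∈ components L, P r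
  | [], _, r, hr => by simp [components] at hr
  | p :: L, h, r, hr =>
    forall_insertMask hP (components L) _ (h p List.mem_cons_self)
      (forall_components hP L fun q hq => h q (List.mem_cons_of_mem _ hq)) r hr

theorem exists_components : ∀ (L : List (ℕ × ℕ)), ∀ p ∈ L,
    ∃ r ∈ components L, r.testBit p.1 ∧ r.testBit p.2
  | q :: L, p, hp => by
    rcases List.mem_cons.1 hp with rfl | hp
    · obtain ⟨r, hr, h⟩ := exists_insertMask (components L) (2 ^ p.1 ||| 2 ^ p.2) _
        List.mem_cons_self
      exact ⟨r, hr, h _ (by simp), h _ (by simp)⟩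
    · obtain ⟨x, hx, h1, h2⟩ := exists_components L p hp
      obtain ⟨r, hr, h⟩ := exists_insertMask (components L) (2 ^ q.1 ||| 2 ^ q.2) x
        (List.mem_cons_of_mem _ hx)
      exact ⟨r, hr, h _ h1, h _ h2⟩

theorem pairwise_components : ∀ L : List (ℕ × ℕ),
    (components L).Pairwise fun a b => a &&& b = 0
  | [] => List.Pairwise.nil
  | _ :: L => pairwise_insertMask _ _ (pairwise_components L)

theorem reachable_of_testBit_components {E : Finset (Sym2 ℕ)} {L : List (ℕ × ℕ)}
    (hE : Represents E L) {r : ℕ} (hr : r ∈ components L) {u v : ℕ} (hu : r.testBit u)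
    (hv : r.testBit v) : (SimpleGraph.fromEdgeSet (E : Set (Sym2 ℕ))).Reachable u v := by
  set G := SimpleGraph.fromEdgeSet (E : Set (Sym2 ℕ))
  refine forall_components (P := fun m => ∀ u v, m.testBit u → m.testBit v → G.Reachable u v)
    ?_ L ?_ r hr u v hu hv
  · intro m c hm hc hmc u v hu hv
    obtain ⟨w, hw⟩ := Nat.exists_testBit_of_ne_zero hmc
    rw [Nat.testBit_and, Bool.and_eq_true] at hw
    have key : ∀ x, (m ||| c).testBit x → G.Reachable x w := fun x hx => by
      rw [Nat.testBit_or, Bool.or_eq_true] at hx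
      exact hx.elim (fun h => hm _ _ h hw.1) fun h => hc _ _ h hw.2
    exact (key u hu).trans (key v hv).symm
  · intro p hp
    have hadj : G.Reachable p.1 p.2 := by
      by_cases h : p.1 = p.2
      · rw [h]
      · exact SimpleGraph.Adj.reachable
          ((SimpleGraph.fromEdgeSet_adj _).2 ⟨(hE _).2 ⟨p, hp, rfl⟩, h⟩)
    have key : ∀ x, (2 ^ p.1 ||| 2 ^ p.2).testBit x → G.Reachable x p.1 := fun x hx => by
      rw [Nat.testBit_or, Nat.testBit_two_pow, Nat.testBit_two_pow, Bool.or_eq_true,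
        decide_eq_true_eq, decide_eq_true_eq] at hx
      rcases hx with rfl | rfl
      · exact SimpleGraph.Reachable.refl _
      · exact hadj.symm
    exact fun u v hu hv => (key u hu).trans (key v hv).symm

theorem testBit_components_of_reachable {E : Finset (Sym2 ℕ)} {L : List (ℕ × ℕ)}
    (hE : Represents E L) {r : ℕ} (hr : r ∈ components L) {u v : ℕ}
    (h : (SimpleGraph.fromEdgeSet (E : Set (Sym2 ℕ))).Reachable u v) (hu : r.testBit u) :
    r.testBit v := by
  obtain ⟨w⟩ := h
  induction w with
  | nil => exact hu
  | @cons u' v _ hadj _ ih =>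
    refine ih ?_
    obtain ⟨p, hp, hpe⟩ := (hE _).1 ((SimpleGraph.fromEdgeSet_adj _).1 hadj).1
    obtain ⟨x, hx, h1, h2⟩ := exists_components L p hp
    have hxu : x.testBit u' ∧ x.testBit v := by
      rcases Sym2.eq_iff.1 hpe with ⟨rfl, rfl⟩ | ⟨rfl, rfl⟩
      exacts [⟨h1, h2⟩, ⟨h2, h1⟩]
    by_cases hxr : x = r
    · exact hxr ▸ hxu.2
    · have : Std.Symm fun a b : ℕ => a &&& b = 0 := ⟨fun a b h => (Nat.and_comm b a).trans h⟩
      have := (pairwise_components L).forall hx hr hxr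
      have hb := congrArg (Nat.testBit · u') this
      simp [hxu.1, hu] at hb

theorem land_two_pow_beq (r k : ℕ) : (!(r.land (Nat.pow 2 k)).beq 0) = r.testBit k := by
  change (!(r &&& 2 ^ k).beq 0) = _
  rw [Nat.and_two_pow]
  cases r.testBit k with
  | false => simp
  | true =>
    have h : (2 ^ k).beq 0 = false := by
      rw [← Bool.not_eq_true, Nat.beq_eq]
      positivity
    simp [h]

/-! ### Feasibility -/

theorem nextIn_eq_nextOf {S : List ℕ} (hS : S.Pairwise (· < ·)) (hne : S ≠ []) (i : ℕ) :
    nextIn S.toFinset i = nextOf S i := by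
  have key : ∀ (F : Finset ℕ) (h : F.Nonempty) (T : List ℕ), T.Pairwise (· < ·) →
      (∀ x, x ∈ F ↔ x ∈ T) → ∀ d, F.min' h = T.headD d := by
    intro F h T hT hF d
    cases T with
    | nil => simpa [hF] using h.choose_spec
    | cons a T =>
      rw [List.pairwise_cons] at hT
      refine le_antisymm (Finset.min'_le _ _ (by simp [hF])) (Finset.le_min' _ _ _ fun y hy => ?_)
      rcases List.mem_cons.1 ((hF y).1 hy) with rfl | hy
      exacts [le_rfl, (hT.1 y hy).le]
  have hF : ∀ x, x ∈ S.toFinset.filter (fun j => i < j) ↔ x ∈ S.filter fun j => i.blt j := by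
    simp [Nat.blt_eq]
  unfold nextIn nextOf
  split_ifs with h h'
  · exact key _ h _ (hS.filter _) hF _
  · have : S.filter (fun j => i.blt j) = [] :=
      List.eq_nil_iff_forall_not_mem.2 fun x hx => h ⟨x, (hF x).2 hx⟩
    rw [this]
    exact key _ h' _ hS (by simp) _
  · exact absurd (List.toFinset_nonempty_iff _ |>.2 hne) h'

theorem represents_union_segEdges {N : Finset (Sym2 ℕ)} {L : List (ℕ × ℕ)} (hN : Represents N L)
    {S : List ℕ} (hS : S.Pairwise (· < ·)) (hne : S ≠ []) :
    Represents (N ∪ segEdges S.toFinset) (L ++ segList S) := by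
  intro e
  simp only [Finset.mem_union, hN e, segEdges, Finset.mem_image, List.mem_toFinset,
    nextIn_eq_nextOf hS hne, segList, List.mem_append, List.mem_map]
  constructor
  · rintro (⟨p, hp, h⟩ | ⟨i, hi, h⟩)
    exacts [⟨p, .inl hp, h⟩, ⟨_, .inr ⟨i, hi, rfl⟩, h⟩]
  · rintro ⟨p, hp | ⟨i, hi, rfl⟩, h⟩
    exacts [.inl ⟨p, hp, h⟩, .inr ⟨i, hi, h⟩]

theorem feasible_eq_true {L : List (ℕ × ℕ)} {S : List ℕ} : feasible L S = true ↔
    ∀ u ∈ pvs S.toFinset, ((components (L ++ segList S)).headD 0).testBit u := by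
  simp only [feasible, land_two_pow_beq, List.all_eq_true, Bool.and_eq_true, pvs,
    Finset.mem_biUnion, List.mem_toFinset, Finset.mem_insert, Finset.mem_singleton]
  constructor
  · rintro h u ⟨i, hi, rfl | rfl⟩
    exacts [(h i hi).1, (h i hi).2]
  · exact fun h i hi => ⟨h _ ⟨i, hi, .inl rfl⟩, h _ ⟨i, hi, .inr rfl⟩⟩

theorem headD_mem_of_testBit {l : List ℕ} {u : ℕ} (h : (l.headD 0).testBit u) : l.headD 0 ∈ l := by
  cases l with
  | nil => simp at h
  | cons a l => simp

theorem feasiblePat_of_feasible {N : Finset (Sym2 ℕ)} {L : List (ℕ × ℕ)} (hN : Represents N L)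
    {S : List ℕ} (hS : S.Pairwise (· < ·)) (h : feasible L S = true) :
    FeasiblePat N S.toFinset := by
  intro u hu v hv
  rw [feasible_eq_true] at h
  have hne : S ≠ [] := by
    rintro rfl
    simp [pvs] at hu
  exact reachable_of_testBit_components (represents_union_segEdges hN hS hne)
    (headD_mem_of_testBit (h u hu)) (h u hu) (h v hv)

theorem toFinset_range' : (List.range' 1 8).toFinset = Finset.Icc 1 8 := by decide

theorem feasible_of_feasiblePat {M : Finset (Sym2 ℕ)} {L : List (ℕ × ℕ)} (hM : Represents M L)
    (hV : ∀ e ∈ M, ∀ v ∈ e, v ∈ pvs (Finset.Icc 1 8)) (h : FeasiblePat M (Finset.Icc 1 8)) :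
    feasible L (List.range' 1 8) = true := by
  rw [feasible_eq_true, toFinset_range']
  have hrep := represents_union_segEdges hM (S := List.range' 1 8) (by decide) (by decide)
  rw [toFinset_range'] at hrep
  have hmem : (components (L ++ segList (List.range' 1 8))).headD 0 ∈
      components (L ++ segList (List.range' 1 8)) := by
    obtain ⟨r, hr, -⟩ := exists_components (L ++ segList (List.range' 1 8)) (2, 3)
      (List.mem_append_right _ (by decide))
    cases hc : components (L ++ segList (List.range' 1 8)) with
    | nil => simp [hc] at hr
    | cons => simp
  obtain ⟨⟨w, hw⟩, hwV⟩ := forall_components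
    (P := fun m => (∃ w, m.testBit w) ∧ ∀ w, m.testBit w → w ∈ pvs (Finset.Icc 1 8))
    (by
      rintro m c ⟨⟨w, hw⟩, hm⟩ ⟨-, hc⟩ -
      refine ⟨⟨w, by simp [hw]⟩, fun x hx => ?_⟩
      rw [Nat.testBit_or, Bool.or_eq_true] at hx
      exact hx.elim (hm x) (hc x))
    (L ++ segList (List.range' 1 8))
    (by
      intro p hp
      refine ⟨⟨p.1, by simp⟩, fun x hx => ?_⟩
      have hpV : p.1 ∈ pvs (Finset.Icc 1 8) ∧ p.2 ∈ pvs (Finset.Icc 1 8) := by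
        rcases List.mem_append.1 hp with hp | hp
        · have he := (hM _).2 ⟨p, hp, rfl⟩
          exact ⟨hV _ he _ (Sym2.mem_mk_left _ _), hV _ he _ (Sym2.mem_mk_right _ _)⟩
        · have hseg : ∀ p ∈ segList (List.range' 1 8),
              (p.1 + 1) / 2 ∈ Finset.Icc 1 8 ∧ (p.2 + 1) / 2 ∈ Finset.Icc 1 8 := by decide
          simpa only [mem_pvs] using hseg p hp
      rw [Nat.testBit_or, Nat.testBit_two_pow, Nat.testBit_two_pow, Bool.or_eq_true,
        decide_eq_true_eq, decide_eq_true_eq] at hx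
      rcases hx with rfl | rfl
      exacts [hpV.1, hpV.2])
    _ hmem
  exact fun v hv => testBit_components_of_reachable hrep hmem (h w (hwV w hw) v hv) hw

/-! ### Reducibility -/

theorem any_beq {S : List ℕ} {k : ℕ} : S.any k.beq = true ↔ k ∈ S := by
  simp [List.any_eq_true, Nat.beq_eq]

theorem represents_subPat {M : Finset (Sym2 ℕ)} {L : List (ℕ × ℕ)} (hM : Represents M L)
    (S : List ℕ) : Represents (subPat M S.toFinset) (subList L S) := by
  intro e
  have hany : ∀ k, (S.any fun i => k.beq i) = true ↔ k ∈ S := fun k => any_beq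
  simp only [subPat, Finset.mem_filter, hM e, subList, List.mem_filter, Bool.and_eq_true, hany,
    Finset.mem_sym2_iff]
  constructor
  · rintro ⟨⟨p, hp, rfl⟩, h⟩
    simp only [mem_pvs, List.mem_toFinset] at h
    exact ⟨p, ⟨hp, h _ (Sym2.mem_mk_left _ _), h _ (Sym2.mem_mk_right _ _)⟩, rfl⟩
  · rintro ⟨p, ⟨hp, h1, h2⟩, rfl⟩
    refine ⟨⟨p, hp, rfl⟩, fun a ha => ?_⟩
    rw [mem_pvs, List.mem_toFinset]
    rcases Sym2.mem_iff.1 ha with rfl | rfl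
    exacts [h1, h2]

theorem isMatchingOn_subPat {M : Finset (Sym2 ℕ)} {A C : Finset ℕ} (hM : IsMatchingOn M (pvs C))
    (hAC : A ⊆ C) (h : ∀ e ∈ M, ∀ u ∈ e, ∀ v ∈ e, u ∈ pvs A → v ∈ pvs A) :
    IsMatchingOn (subPat M A) (pvs A) := by
  obtain ⟨hd, -, hu⟩ := hM
  refine ⟨fun e he => hd e (Finset.mem_filter.1 he).1,
    fun e he => Finset.mem_sym2_iff.1 (Finset.mem_filter.1 he).2, fun v hv => ?_⟩
  obtain ⟨e, ⟨he, hve⟩, huniq⟩ := hu v (mem_pvs.2 (hAC (mem_pvs.1 hv)))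
  exact ⟨e, ⟨Finset.mem_filter.2 ⟨he, Finset.mem_sym2_iff.2 fun w hw => h e he v hve w hw hv⟩, hve⟩,
    fun e' ⟨he', hv'⟩ => huniq e' ⟨(Finset.mem_filter.1 he').1, hv'⟩⟩

theorem reducible_of_splits {M : Finset (Sym2 ℕ)} {L : List (ℕ × ℕ)} (hM : Represents M L)
    (hmatch : IsMatchingOn M (pvs (Finset.Icc 1 8))) {T : List ℕ} (h : splits L T = true) :
    Reducible M 8 := by
  simp only [splits, Bool.and_eq_true, Bool.not_eq_true', List.isEmpty_eq_false_iff,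
    List.all_eq_true] at h
  obtain ⟨⟨⟨⟨hin, hout⟩, hcross⟩, hfin⟩, hfout⟩ := h
  have hmi : ∀ k, k ∈ (inside T).toFinset ↔ k ∈ Finset.Icc 1 8 ∧ k ∈ T := fun k => by
    rw [← toFinset_range', List.mem_toFinset, List.mem_toFinset, inside, List.mem_filter, any_beq]
  have hmo : ∀ k, k ∈ (outside T).toFinset ↔ k ∈ Finset.Icc 1 8 ∧ k ∉ T := fun k => by
    rw [← toFinset_range', List.mem_toFinset, List.mem_toFinset, outside, List.mem_filter,
      Bool.not_eq_true', ← Bool.not_eq_true, any_beq]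
  have hiff : ∀ e ∈ M, ∀ u ∈ e, ∀ v ∈ e, ((u + 1) / 2 ∈ T ↔ (v + 1) / 2 ∈ T) := by
    intro e he u hu v hv
    obtain ⟨p, hp, rfl⟩ := (hM e).1 he
    have hc := hcross p hp
    have hp' : (p.1 + 1) / 2 ∈ T ↔ (p.2 + 1) / 2 ∈ T := by
      rw [← any_beq, ← any_beq]
      revert hc
      cases T.any ((p.1 + 1) / 2).beq <;> cases T.any ((p.2 + 1) / 2).beq <;> simp
    rcases Sym2.mem_iff.1 hu with rfl | rfl <;> rcases Sym2.mem_iff.1 hv with rfl | rfl <;>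
      simp [hp']
  have hV : ∀ e ∈ M, ∀ v ∈ e, (v + 1) / 2 ∈ Finset.Icc 1 8 := fun e he v hv =>
    mem_pvs.1 (hmatch.2.1 e he v hv)
  have hsorted : (List.range' 1 8).Pairwise (· < ·) := by decide
  refine ⟨(inside T).toFinset, (outside T).toFinset, ?_, ?_, (List.toFinset_nonempty_iff _).2 hin,
    (List.toFinset_nonempty_iff _).2 hout, ?_, ?_,
    feasiblePat_of_feasible (represents_subPat hM _) (hsorted.filter _) hfin,
    feasiblePat_of_feasible (represents_subPat hM _) (hsorted.filter _) hfout⟩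
  · ext k
    rw [Finset.mem_union, hmi, hmo]
    tauto
  · rw [Finset.disjoint_left]
    intro k hk hk'
    exact ((hmo k).1 hk').2 ((hmi k).1 hk).2
  · refine isMatchingOn_subPat hmatch (fun k hk => ((hmi k).1 hk).1) fun e he u hu v hv huA => ?_
    rw [mem_pvs, hmi] at huA ⊢
    exact ⟨hV e he v hv, (hiff e he u hu v hv).1 huA.2⟩
  · refine isMatchingOn_subPat hmatch (fun k hk => ((hmo k).1 hk).1) fun e he u hu v hv huA => ?_
    rw [mem_pvs, hmo] at huA ⊢
    exact ⟨hV e he v hv, fun h => huA.2 ((hiff e he u hu v hv).2 h)⟩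

/-! ### Swapping adjacent indices -/

theorem swapVertex_eq {i : ℕ} (hi : 1 ≤ i) (m : ℕ) :
    Equiv.swap (2 * i - 1) (2 * i + 1) (Equiv.swap (2 * i) (2 * i + 2) m) = swapVertex i m := by
  simp only [swapVertex, Equiv.swap_apply_def, Bool.cond_eq_ite, Nat.beq_eq]
  split_ifs <;> omega

theorem represents_swapAdjPat {M : Finset (Sym2 ℕ)} {L : List (ℕ × ℕ)} (hM : Represents M L)
    {i : ℕ} (hi : 1 ≤ i) : Represents (swapAdjPat M i) (swapList L i) := by
  intro e
  simp only [swapAdjPat, Finset.mem_image, hM _, swapList, List.mem_map, swapVertex_eq hi]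
  constructor
  · rintro ⟨_, ⟨p, hp, rfl⟩, rfl⟩
    exact ⟨_, ⟨p, hp, rfl⟩, rfl⟩
  · rintro ⟨_, ⟨p, hp, rfl⟩, rfl⟩
    exact ⟨_, ⟨p, hp, rfl⟩, rfl⟩

theorem isMatchingOn_image {M : Finset (Sym2 ℕ)} {S : Finset ℕ} (hM : IsMatchingOn M S)
    (σ : Equiv.Perm ℕ) (hσ : ∀ v, σ v ∈ S ↔ v ∈ S) : IsMatchingOn (M.image (Sym2.map σ)) S := by
  obtain ⟨hd, hV, hu⟩ := hM
  refine ⟨?_, ?_, fun v hv => ?_⟩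
  · intro e' he'
    obtain ⟨e, he, rfl⟩ := Finset.mem_image.1 he'
    rw [Sym2.isDiag_map σ.injective]
    exact hd e he
  · intro e' he' v hv
    obtain ⟨e, he, rfl⟩ := Finset.mem_image.1 he'
    obtain ⟨w, hw, rfl⟩ := Sym2.mem_map.1 hv
    exact (hσ w).2 (hV e he w hw)
  · obtain ⟨w, rfl⟩ := σ.surjective v
    obtain ⟨e, ⟨he, hwe⟩, huniq⟩ := hu w ((hσ w).1 hv)
    refine ⟨e.map σ, ⟨Finset.mem_image_of_mem _ he, Sym2.mem_map.2 ⟨w, hwe, rfl⟩⟩, ?_⟩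
    rintro e' ⟨he', hw'⟩
    obtain ⟨f, hf, rfl⟩ := Finset.mem_image.1 he'
    obtain ⟨w', hw', hww⟩ := Sym2.mem_map.1 hw'
    rw [huniq f ⟨hf, σ.injective hww ▸ hw'⟩]

theorem isMatchingOn_swapAdjPat {M : Finset (Sym2 ℕ)} {i : ℕ}
    (hM : IsMatchingOn M (pvs (Finset.Icc 1 8))) (hi : 1 ≤ i) (hi' : i ≤ 7) :
    IsMatchingOn (swapAdjPat M i) (pvs (Finset.Icc 1 8)) := by
  refine isMatchingOn_image hM
    ((Equiv.swap (2 * i) (2 * i + 2)).trans (Equiv.swap (2 * i - 1) (2 * i + 1))) fun v => ?_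
  rw [Equiv.trans_apply, swapVertex_eq hi, mem_pvs, mem_pvs, Finset.mem_Icc, Finset.mem_Icc]
  simp only [swapVertex, Bool.cond_eq_ite, Nat.beq_eq]
  split_ifs <;> omega

theorem feasiblePat_or_reducible {M : Finset (Sym2 ℕ)} {L : List (ℕ × ℕ)} (hM : Represents M L)
    (hmatch : IsMatchingOn M (pvs (Finset.Icc 1 8))) {Ts : List (List ℕ)}
    (h : feasibleOrSplits L Ts = true) : FeasiblePat M (Finset.Icc 1 8) ∨ Reducible M 8 := by
  rw [feasibleOrSplits, Bool.or_eq_true, List.any_eq_true] at h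
  rcases h with h | ⟨T, -, hT⟩
  · left
    rw [← toFinset_range']
    exact feasiblePat_of_feasible hM (by decide) h
  · exact .inr (reducible_of_splits hM hmatch hT)

theorem of_swapsWell {M : Finset (Sym2 ℕ)} {L : List (ℕ × ℕ)} (hM : Represents M L)
    (hmatch : IsMatchingOn M (pvs (Finset.Icc 1 8))) {Ts : List (List ℕ)} {a : ℕ} {A : List ℕ}
    (ha : 2 ≤ a) (ha' : a ≤ 7) (h : swapsWell L Ts a A = true) :
    (a - 2 ∉ A.toFinset ∧ a + 2 ∉ A.toFinset) ∧
      (FeasiblePat (swapAdjPat M a) (Finset.Icc 1 8) ∨ Reducible (swapAdjPat M a) 8) ∧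
      (FeasiblePat (swapAdjPat M (a - 1)) (Finset.Icc 1 8) ∨
        Reducible (swapAdjPat M (a - 1)) 8) := by
  simp only [swapsWell, Bool.and_eq_true, Bool.not_eq_true', ← Bool.not_eq_true, any_beq] at h
  obtain ⟨⟨⟨h1, h2⟩, h3⟩, h4⟩ := h
  refine ⟨⟨by simpa using h1, by simpa using h2⟩, ?_, ?_⟩
  · exact feasiblePat_or_reducible (represents_swapAdjPat hM (by omega))
      (isMatchingOn_swapAdjPat hmatch (by omega) ha') h3
  · exact feasiblePat_or_reducible (represents_swapAdjPat hM (by omega))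
      (isMatchingOn_swapAdjPat hmatch (by omega) (by omega)) h4

/-! ### Sequential patterns -/

theorem IsMatchingOn.exists_mate {N : Finset (Sym2 ℕ)} {S : Finset ℕ} (hN : IsMatchingOn N S) :
    ∃ p : ℕ → ℕ, (∀ x ∈ S, p x ∈ S ∧ p x ≠ x ∧ p (p x) = x) ∧
      ∀ e, e ∈ N ↔ ∃ x ∈ S, s(x, p x) = e := by
  obtain ⟨hd, hV, hu⟩ := hN
  have hex : ∀ x, ∃ y, x ∈ S → s(x, y) ∈ N := fun x => by
    by_cases hx : x ∈ S
    · obtain ⟨e, ⟨he, y, rfl⟩, -⟩ := hu x hx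
      exact ⟨y, fun _ => he⟩
    · exact ⟨0, fun h => absurd h hx⟩
  choose p hp using hex
  have huniq : ∀ x ∈ S, ∀ y, s(x, y) ∈ N → y = p x := fun x hx y hy =>
    Sym2.congr_right.1 ((hu x hx).unique ⟨hy, Sym2.mem_mk_left _ _⟩
      ⟨hp x hx, Sym2.mem_mk_left _ _⟩)
  have hpS : ∀ x ∈ S, p x ∈ S := fun x hx => hV _ (hp x hx) _ (Sym2.mem_mk_right _ _)
  refine ⟨p, fun x hx => ⟨hpS x hx, fun h => hd _ (hp x hx) (Sym2.mk_isDiag_iff.2 h.symm), ?_⟩,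
    fun e => ⟨fun he => ?_, ?_⟩⟩
  · exact (huniq _ (hpS x hx) x (Sym2.eq_swap ▸ hp x hx)).symm
  · induction e with
    | _ x y =>
      have hx := hV _ he _ (Sym2.mem_mk_left _ _)
      exact ⟨x, hx, by rw [huniq x hx y he]⟩
  · rintro ⟨x, hx, rfl⟩
    exact hp x hx

theorem SequentialPat.notMem {N : Finset (Sym2 ℕ)} {X : Finset ℕ} (hN : IsMatchingOn N (pvs X))
    (hs : SequentialPat N X) {a b : ℕ} (ha : a ∈ X) (hb : b ∈ X) (hab : a ≠ b) :
    s(2 * a - 1, 2 * a) ∉ N := by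
  intro hmem
  have key : ∀ u v : ℕ, (SimpleGraph.fromEdgeSet
      ((N ∪ X.image fun i => s(2 * i - 1, 2 * i) : Finset (Sym2 ℕ)) : Set (Sym2 ℕ))).Reachable u v →
      (u + 1) / 2 = a → (v + 1) / 2 = a := by
    rintro u v ⟨w⟩ hu
    induction w with
    | nil => exact hu
    | @cons u v w hadj _ ih =>
      refine ih ?_
      rw [SimpleGraph.fromEdgeSet_adj, Finset.mem_coe, Finset.mem_union, Finset.mem_image] at hadj
      have haux : ∀ i, s(2 * i - 1, 2 * i) = s(u, v) → (v + 1) / 2 = a := fun i h => by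
        rcases Sym2.eq_iff.1 h with ⟨rfl, rfl⟩ | ⟨rfl, rfl⟩ <;> omega
      rcases hadj.1 with h | ⟨i, -, h⟩
      · refine haux a ((hN.2.2 u (mem_pvs.2 (hu ▸ ha))).unique ⟨hmem, ?_⟩
          ⟨h, Sym2.mem_mk_left _ _⟩)
        rw [Sym2.mem_iff]
        omega
      · exact haux i h
  have h := key (2 * a) (2 * b) (hs _ (mem_pvs.2 (by convert ha using 1; omega)) _
    (mem_pvs.2 (by convert hb using 1; omega))) (by omega)
  omega

theorem represents_of_mate {N : Finset (Sym2 ℕ)} {S : Finset ℕ} {p : ℕ → ℕ}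
    (hp : ∀ x ∈ S, p (p x) = x) (hN : ∀ e, e ∈ N ↔ ∃ x ∈ S, s(x, p x) = e) {L : List (ℕ × ℕ)}
    (hL : ∀ q ∈ L, q.1 ∈ S ∧ p q.1 = q.2) (hS : ∀ x ∈ S, ∃ q ∈ L, x = q.1 ∨ x = q.2) :
    Represents N L := by
  intro e
  rw [hN]
  constructor
  · rintro ⟨x, hx, rfl⟩
    obtain ⟨q, hq, rfl | rfl⟩ := hS x hx
    · exact ⟨q, hq, by rw [(hL q hq).2]⟩
    · obtain ⟨h1, h2⟩ := hL q hq
      exact ⟨q, hq, by rw [← h2, hp _ h1, Sym2.eq_swap]⟩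
  · rintro ⟨q, hq, rfl⟩
    obtain ⟨h1, h2⟩ := hL q hq
    exact ⟨q.1, h1, by rw [h2]⟩

/-- The mates in a sequential pattern are in the pattern, and the two ends of a deleted edge are
never mates. -/
theorem SequentialPat.exists_mate {N : Finset (Sym2 ℕ)} {X : Finset ℕ}
    (hN : IsMatchingOn N (pvs X)) (hs : SequentialPat N X) (hX : X.Nontrivial)
    (h0 : 0 ∉ X) :
    ∃ p : ℕ → ℕ, (∀ x ∈ pvs X, p x ∈ pvs X ∧ (p x + 1) / 2 ≠ (x + 1) / 2 ∧ p (p x) = x) ∧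
      ∀ e, e ∈ N ↔ ∃ x ∈ pvs X, s(x, p x) = e := by
  obtain ⟨p, hp, hpN⟩ := hN.exists_mate
  refine ⟨p, fun x hx => ⟨(hp x hx).1, fun h => ?_, (hp x hx).2.2⟩, hpN⟩
  have hxX := mem_pvs.1 hx
  obtain ⟨b, hb, hne⟩ := hX.exists_ne ((x + 1) / 2)
  refine hs.notMem hN hxX hb hne.symm ((hpN _).2 ⟨x, hx, ?_⟩)
  have h1 : (x + 1) / 2 ≠ 0 := fun h => h0 (h ▸ hxX)
  have := (hp x hx).2.1
  rw [Sym2.eq_iff]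
  omega

theorem exists_patterns₂ {N : Finset (Sym2 ℕ)} {a b : ℕ} (ha : 1 ≤ a) (hb : 1 ≤ b) (hab : a ≠ b)
    (hN : IsMatchingOn N (pvs {a, b})) (hs : SequentialPat N {a, b}) :
    ∃ L ∈ patterns₂ a b, Represents N L := by
  obtain ⟨p, hp, hpN⟩ := hs.exists_mate hN ⟨a, by simp, b, by simp, hab⟩
    (by simp only [Finset.mem_insert, Finset.mem_singleton]; omega)
  have hmem : ∀ x, x ∈ pvs {a, b} ↔ x = 2 * a - 1 ∨ x = 2 * a ∨ x = 2 * b - 1 ∨ x = 2 * b := by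
    intro x
    simp only [mem_pvs, Finset.mem_insert, Finset.mem_singleton]
    omega
  have h1 := hp (2 * a - 1) (by simp [hmem])
  have h2 := hp (2 * a) (by simp [hmem])
  rw [hmem] at h1 h2
  have key : (p (2 * a - 1) = 2 * b - 1 ∧ p (2 * a) = 2 * b) ∨
      (p (2 * a - 1) = 2 * b ∧ p (2 * a) = 2 * b - 1) := by
    obtain ⟨h1, h1', h1''⟩ := h1
    obtain ⟨h2, h2', h2''⟩ := h2
    have hne : p (2 * a - 1) ≠ p (2 * a) := fun h => by
      rw [h, h2''] at h1''
      omega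
    omega
  have hrep : ∀ L : List (ℕ × ℕ), (∀ q ∈ L, q.1 ∈ pvs {a, b} ∧ p q.1 = q.2) →
      (∀ x ∈ pvs {a, b}, ∃ q ∈ L, x = q.1 ∨ x = q.2) → Represents N L :=
    fun L => represents_of_mate (fun x hx => (hp x hx).2.2) hpN
  simp only [hmem] at hrep
  rcases key with h | h
  · exact ⟨_, List.mem_cons_self, hrep _ (by simp [h]) (by simp)⟩
  · exact ⟨_, List.mem_cons_of_mem _ List.mem_cons_self, hrep _ (by simp [h]) (by simp)⟩

theorem mates_of_mate_eq {S : Finset ℕ} {p : ℕ → ℕ} {u u' v v' w w' : ℕ}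
    (hd : [u, u', v, v', w, w'].Nodup)
    (hS : ∀ x, x ∈ S ↔ x = u ∨ x = u' ∨ x = v ∨ x = v' ∨ x = w ∨ x = w')
    (hp : ∀ x ∈ S, p x ∈ S ∧ p x ≠ x ∧ p (p x) = x) (hw : p w ≠ w') (h : p u = v) :
    (p u' = w ∧ p v' = w') ∨ (p u' = w' ∧ p v' = w) := by
  simp only [List.nodup_cons, List.mem_cons, List.not_mem_nil, or_false, not_or] at hd
  have hu := hp u (by simp [hS])
  have hu' := hp u' (by simp [hS])
  have hv' := hp v' (by simp [hS])
  have hww := hp w (by simp [hS])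
  rw [h] at hu
  simp only [hS] at hu' hv' hww
  rcases hu'.1 with h₁ | h₁ | h₁ | h₁ | h₁ | h₁ <;>
  rcases hv'.1 with h₂ | h₂ | h₂ | h₂ | h₂ | h₂ <;>
  grind

theorem exists_halfPatterns₃ {N : Finset (Sym2 ℕ)} {S : Finset ℕ} {p : ℕ → ℕ} {a b c : ℕ}
    (ha : 1 ≤ a) (hb : 1 ≤ b) (hc : 1 ≤ c) (hab : a ≠ b) (hac : a ≠ c) (hbc : b ≠ c)
    (hS : ∀ x, x ∈ S ↔ x = 2 * a - 1 ∨ x = 2 * a ∨ x = 2 * b - 1 ∨ x = 2 * b ∨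
      x = 2 * c - 1 ∨ x = 2 * c)
    (hp : ∀ x ∈ S, p x ∈ S ∧ (p x + 1) / 2 ≠ (x + 1) / 2 ∧ p (p x) = x)
    (hN : ∀ e, e ∈ N ↔ ∃ x ∈ S, s(x, p x) = e)
    (h : p (2 * a - 1) = 2 * b - 1 ∨ p (2 * a - 1) = 2 * b) :
    ∃ L ∈ halfPatterns₃ a b c, Represents N L := by
  have hrep : ∀ L : List (ℕ × ℕ), (∀ q ∈ L, q.1 ∈ S ∧ p q.1 = q.2) →
      (∀ x ∈ S, ∃ q ∈ L, x = q.1 ∨ x = q.2) → Represents N L :=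
    fun L => represents_of_mate (fun x hx => (hp x hx).2.2) hN
  simp only [hS] at hrep
  have hp' : ∀ x ∈ S, p x ∈ S ∧ p x ≠ x ∧ p (p x) = x := fun x hx =>
    ⟨(hp x hx).1, fun h => (hp x hx).2.1 (by rw [h]), (hp x hx).2.2⟩
  have hw : p (2 * c - 1) ≠ 2 * c := by
    have := (hp (2 * c - 1) (by simp [hS])).2.1
    omega
  simp only [halfPatterns₃, List.mem_cons, List.not_mem_nil, or_false, exists_eq_or_imp,
    exists_eq_left]
  rcases h with h | h
  · rcases mates_of_mate_eq (u' := 2 * a) (v' := 2 * b) (by simp; omega) (by simpa using hS)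
      hp' hw h with h' | h'
    · exact .inl (hrep _ (by simp [h, h']) (by simp))
    · exact .inr (.inl (hrep _ (by simp [h, h']) (by simp)))
  · rcases mates_of_mate_eq (u' := 2 * a) (v' := 2 * b - 1) (by simp; omega)
      (fun x => (hS x).trans (by tauto)) hp' hw h with h' | h'
    · exact .inr (.inr (.inl (hrep _ (by simp [h, h']) (by simp))))
    · exact .inr (.inr (.inr (hrep _ (by simp [h, h']) (by simp))))

theorem exists_patterns₃ {N : Finset (Sym2 ℕ)} {a b c : ℕ} (ha : 1 ≤ a) (hb : 1 ≤ b) (hc : 1 ≤ c)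
    (hab : a ≠ b) (hac : a ≠ c) (hbc : b ≠ c)
    (hN : IsMatchingOn N (pvs {a, b, c})) (hs : SequentialPat N {a, b, c}) :
    ∃ L ∈ patterns₃ a b c, Represents N L := by
  obtain ⟨p, hp, hpN⟩ := hs.exists_mate hN ⟨a, by simp, b, by simp, hab⟩
    (by simp only [Finset.mem_insert, Finset.mem_singleton]; omega)
  have hmem : ∀ x, x ∈ pvs {a, b, c} ↔ x = 2 * a - 1 ∨ x = 2 * a ∨ x = 2 * b - 1 ∨ x = 2 * b ∨
      x = 2 * c - 1 ∨ x = 2 * c := by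
    intro x
    simp only [mem_pvs, Finset.mem_insert, Finset.mem_singleton]
    omega
  have h := hp (2 * a - 1) (by simp [hmem])
  rw [hmem] at h
  by_cases hpb : p (2 * a - 1) = 2 * b - 1 ∨ p (2 * a - 1) = 2 * b
  · obtain ⟨L, hL, hrep⟩ := exists_halfPatterns₃ ha hb hc hab hac hbc hmem hp hpN hpb
    exact ⟨L, List.mem_append_left _ hL, hrep⟩
  · obtain ⟨L, hL, hrep⟩ := exists_halfPatterns₃ ha hc hb hac hab hbc.symm
      (fun x => (hmem x).trans (by omega)) hp hpN (by omega)
    exact ⟨L, List.mem_append_right _ hL, hrep⟩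

theorem Represents.union {N₁ N₂ : Finset (Sym2 ℕ)} {L₁ L₂ : List (ℕ × ℕ)}
    (h₁ : Represents N₁ L₁) (h₂ : Represents N₂ L₂) : Represents (N₁ ∪ N₂) (L₁ ++ L₂) := by
  intro e
  simp only [Finset.mem_union, h₁ e, h₂ e, List.mem_append, or_and_right, exists_or]

theorem subPat_union_subPat {M : Finset (Sym2 ℕ)} {X Y Z C : Finset ℕ}
    (hM : IsMatchingOn M (pvs C)) (hpart : X ∪ Y ∪ Z = C)
    (hMX : IsMatchingOn (subPat M X) (pvs X)) (hMY : IsMatchingOn (subPat M Y) (pvs Y))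
    (hMZ : IsMatchingOn (subPat M Z) (pvs Z)) :
    subPat M X ∪ (subPat M Y ∪ subPat M Z) = M := by
  ext e
  constructor
  · simp only [Finset.mem_union, subPat, Finset.mem_filter]
    tauto
  · intro he
    obtain ⟨v, hv⟩ : ∃ v, v ∈ e := ⟨_, e.out_fst_mem⟩
    have hvC := hM.2.1 e he v hv
    have key : ∀ A, IsMatchingOn (subPat M A) (pvs A) → v ∈ pvs A → e ∈ subPat M A := by
      intro A hA hvA
      obtain ⟨e', ⟨he', hv'⟩, -⟩ := hA.2.2 v hvA
      rwa [(hM.2.2 v hvC).unique ⟨he, hv⟩ ⟨(Finset.mem_filter.1 he').1, hv'⟩]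
    have hv' := mem_pvs.1 hvC
    simp only [← hpart, Finset.mem_union, ← mem_pvs] at hv'
    simp only [Finset.mem_union]
    rcases hv' with (h | h) | h
    exacts [.inl (key X hMX h), .inr (.inl (key Y hMY h)), .inr (.inr (key Z hMZ h))]

theorem Finset.exists_eq_insert_insert {α : Type*} [DecidableEq α] {A : Finset α} {a b : α}
    (hA : A.card = 3) (hab : a ≠ b) (h : {a, b} ⊆ A) :
    ∃ c, a ≠ c ∧ b ≠ c ∧ A = {a, b, c} := by
  obtain ⟨c, hc⟩ := Finset.card_eq_one.1
    (show (A \ {a, b}).card = 1 by rw [Finset.card_sdiff_of_subset h, hA, Finset.card_pair hab])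
  have hcm : c ∈ A \ {a, b} := hc ▸ Finset.mem_singleton_self c
  simp only [Finset.mem_sdiff, Finset.mem_insert, Finset.mem_singleton, not_or] at hcm
  refine ⟨c, Ne.symm hcm.2.1, Ne.symm hcm.2.2, ?_⟩
  rw [← Finset.union_sdiff_of_subset h, hc]
  ext
  simp

/-- The theorem in the case `i < j`. -/
theorem eight_pattern_swap_lemma_of_lt (M : Finset (Sym2 ℕ)) (X Y Z : Finset ℕ) (i j : ℕ)
    (hM : IsMatchingOn M (pvs (Finset.Icc 1 8)))
    (hfeas : FeasiblePat M (Finset.Icc 1 8))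
    (hirr : ¬ Reducible M 8)
    (hpart : X ∪ Y ∪ Z = Finset.Icc 1 8)
    (hXij : X = {i, j}) (hij : i < j) (hY3 : Y.card = 3) (hZ3 : Z.card = 3)
    (hMX : IsMatchingOn (subPat M X) (pvs X)) (hsX : SequentialPat (subPat M X) X)
    (hMY : IsMatchingOn (subPat M Y) (pvs Y)) (hsY : SequentialPat (subPat M Y) Y)
    (hMZ : IsMatchingOn (subPat M Z) (pvs Z)) (hsZ : SequentialPat (subPat M Z) Z)
    (hiY : ({i - 1, i + 1} : Finset ℕ) ⊆ Y)
    (hjZ : ({j - 1, j + 1} : Finset ℕ) ⊆ Z) :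
    ((i - 2 ∉ Y ∧ i + 2 ∉ Y) ∧
      (FeasiblePat (swapAdjPat M i) (Finset.Icc 1 8) ∨ Reducible (swapAdjPat M i) 8) ∧
      (FeasiblePat (swapAdjPat M (i - 1)) (Finset.Icc 1 8) ∨
        Reducible (swapAdjPat M (i - 1)) 8)) ∨
    ((j - 2 ∉ Z ∧ j + 2 ∉ Z) ∧
      (FeasiblePat (swapAdjPat M j) (Finset.Icc 1 8) ∨ Reducible (swapAdjPat M j) 8) ∧
      (FeasiblePat (swapAdjPat M (j - 1)) (Finset.Icc 1 8) ∨
        Reducible (swapAdjPat M (j - 1)) 8)) := by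
  obtain ⟨y, hy, hy', rfl⟩ := Finset.exists_eq_insert_insert hY3 (by omega) hiY
  obtain ⟨z, hz, hz', rfl⟩ := Finset.exists_eq_insert_insert hZ3 (by omega) hjZ
  subst hXij
  have hmem : ∀ k, k ∈ [i, j, i - 1, i + 1, y, j - 1, j + 1, z] ↔ k ∈ Finset.Icc 1 8 := fun k => by
    simp only [← hpart, Finset.mem_union, Finset.mem_insert, Finset.mem_singleton, List.mem_cons,
      List.not_mem_nil, or_false, or_assoc]
  have hIcc := fun k => (hmem k).1
  simp only [List.forall_mem_cons, Finset.mem_Icc, List.not_mem_nil, IsEmpty.forall_iff,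
    implies_true, and_true] at hIcc
  obtain ⟨hi, hj, hi₁, hi₂, hy₁, hj₁, hj₂, hz₁⟩ := hIcc
  obtain ⟨lx, hlx, hrx⟩ := exists_patterns₂ hi.1 hj.1 hij.ne hMX hsX
  obtain ⟨ly, hly, hry⟩ := exists_patterns₃ hi₁.1 hi₂.1 hy₁.1 (by omega) hy hy' hMY hsY
  obtain ⟨lz, hlz, hrz⟩ := exists_patterns₃ hj₁.1 hj₂.1 hz₁.1 (by omega) hz hz' hMZ hsZ
  have hrep := hrx.union (hry.union hrz)
  rw [subPat_union_subPat hM hpart hMX hMY hMZ] at hrep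
  have hrange : ∀ k, 1 ≤ k ∧ k ≤ 8 → k ∈ List.range' 1 8 := fun k hk => by
    rw [List.mem_range'_1]
    omega
  have hcov : covers i j y z = true := by
    rw [covers, List.all_eq_true]
    intro k hk
    rw [any_beq, hmem, ← toFinset_range', List.mem_toFinset]
    exact hk
  have hgood := goodPartition_of_le i (hrange i hi) j (hrange j hj) y (hrange y hy₁) z
    (hrange z hz₁)
  have hle : j.ble i = false := by
    rw [← Bool.not_eq_true, Nat.ble_eq]
    omega
  simp only [goodPartition, hle, hcov, Bool.not_true, Bool.or_self, Bool.false_or,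
    List.all_eq_true] at hgood
  have h := hgood lx hlx ly hly lz hlz
  simp only [goodPattern, feasible_of_feasiblePat hrep hM.2.1 hfeas, Bool.not_true,
    Bool.false_or, Bool.or_eq_true, List.any_eq_true, or_assoc] at h
  rcases h with ⟨T, -, hT⟩ | h | h
  · exact absurd (reducible_of_splits hrep hM hT) hirr
  · left
    simpa using of_swapsWell hrep hM (by omega) (by omega) h
  · right
    simpa using of_swapsWell hrep hM (by omega) (by omega) h

/-- Let `M` be a feasible irreducible connection 8-pattern that decomposes into three
sequential swaps `M[X]`, `M[Y]`, `M[Z]` with `[8] = X ⊎ Y ⊎ Z`, `X = {i, j}`,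
`|Y| = |Z| = 3`, and suppose `{i−1, i+1} ⊆ Y` and `{j−1, j+1} ⊆ Z`.  Then for at least
one of the pairs `(a, A) ∈ {(i, Y), (j, Z)}` all of the following hold:
(1) `a−2 ∉ A` and `a+2 ∉ A`;
(2) the pattern obtained from `M` by swapping `a` and `a+1` is feasible or reducible;
(3) the pattern obtained from `M` by swapping `a` and `a−1` is feasible or reducible. -/
theorem eight_pattern_swap_lemma (M : Finset (Sym2 ℕ)) (X Y Z : Finset ℕ) (i j : ℕ)
    (hM : IsMatchingOn M (pvs (Finset.Icc 1 8)))
    (hfeas : FeasiblePat M (Finset.Icc 1 8))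
    (hirr : ¬ Reducible M 8)
    (hpart : X ∪ Y ∪ Z = Finset.Icc 1 8)
    (hXY : Disjoint X Y) (hXZ : Disjoint X Z) (hYZ : Disjoint Y Z)
    (hXij : X = {i, j}) (hij : i ≠ j) (hY3 : Y.card = 3) (hZ3 : Z.card = 3)
    (hMX : IsMatchingOn (subPat M X) (pvs X)) (hsX : SequentialPat (subPat M X) X)
    (hMY : IsMatchingOn (subPat M Y) (pvs Y)) (hsY : SequentialPat (subPat M Y) Y)
    (hMZ : IsMatchingOn (subPat M Z) (pvs Z)) (hsZ : SequentialPat (subPat M Z) Z)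
    (hiY : ({i - 1, i + 1} : Finset ℕ) ⊆ Y)
    (hjZ : ({j - 1, j + 1} : Finset ℕ) ⊆ Z) :
    ((i - 2 ∉ Y ∧ i + 2 ∉ Y) ∧
      (FeasiblePat (swapAdjPat M i) (Finset.Icc 1 8) ∨ Reducible (swapAdjPat M i) 8) ∧
      (FeasiblePat (swapAdjPat M (i - 1)) (Finset.Icc 1 8) ∨
        Reducible (swapAdjPat M (i - 1)) 8)) ∨
    ((j - 2 ∉ Z ∧ j + 2 ∉ Z) ∧
      (FeasiblePat (swapAdjPat M j) (Finset.Icc 1 8) ∨ Reducible (swapAdjPat M j) 8) ∧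
      (FeasiblePat (swapAdjPat M (j - 1)) (Finset.Icc 1 8) ∨
        Reducible (swapAdjPat M (j - 1)) 8)) := by
  rcases lt_or_gt_of_ne hij with h | h
  · exact eight_pattern_swap_lemma_of_lt M X Y Z i j hM hfeas hirr hpart hXij h hY3 hZ3
      hMX hsX hMY hsY hMZ hsZ hiY hjZ
  · refine (eight_pattern_swap_lemma_of_lt M X Z Y j i hM hfeas hirr ?_ ?_ h hZ3 hY3
      hMX hsX hMZ hsZ hMY hsY hjZ hiY).symm
    · rw [Finset.union_right_comm, hpart]
    · rw [hXij, Finset.pair_comm]
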